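/- Let k_E/k_F be a finite extension of finite fields of degree r and ψ a nontrivial additive character of k_F. Then for every non-negative integer n and every a ∈ k_F^×, one has Kl_a^{n,r}(ψ; k_E/k_F) = (−1)^{r−1} · Kl_a^{n+1,0}(ψ; k_E/k_F). -/

import Mathlib

/-- The Kloosterman sum `Kl_a^{n,m}(ψ; k_E/k_F)`:
the sum of `ψ(Tr(t₁+⋯+t_n))·ψ(s₁+⋯+s_m)` over `t₁,…,t_n ∈ k_E^×` and
`s₁,…,s_m ∈ k_F^×` with `Nr(t₁)⋯Nr(t_n)·s₁⋯s_m = a`. -/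
noncomputable def Kl (kF kE : Type) [Field kF] [Fintype kF] [DecidableEq kF]
    [Field kE] [Fintype kE] [DecidableEq kE] [Algebra kF kE]
    (ψ : AddChar kF ℂ) (n m : ℕ) (a : kF) : ℂ :=
  ∑ t : Fin n → kEˣ, ∑ s : Fin m → kFˣ,
    if (∏ i, Algebra.norm kF ((t i : kE))) * (∏ j, ((s j : kF))) = a then
      ψ (Algebra.trace kF kE (∑ i, ((t i : kE)))) * ψ (∑ j, ((s j : kF)))
    else 0

section HasseDavenport

open Polynomial UniqueFactorizationMonoid

variable {F : Type*} [Field F] {R : Type*} [CommRing R] (χ : MulChar F R) (ψ : AddChar F R)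

/-- For monic `f` with roots `αᵢ`, the value `χ (∏ αᵢ) * ψ (∑ αᵢ)`. -/
noncomputable def polyChar (f : F[X]) : R :=
  χ ((-1) ^ f.natDegree * f.coeff 0) * ψ (-f.nextCoeff)

theorem polyChar_one : polyChar χ ψ 1 = 1 := by
  simp [polyChar, nextCoeff]

theorem polyChar_mul {f g : F[X]} (hf : f.Monic) (hg : g.Monic) :
    polyChar χ ψ (f * g) = polyChar χ ψ f * polyChar χ ψ g := by
  simp only [polyChar, hf.natDegree_mul hg, hf.nextCoeff_mul hg, mul_coeff_zero, neg_add,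
    AddChar.map_add_eq_mul, map_mul, pow_add]
  ring

theorem polyChar_pow {f : F[X]} (hf : f.Monic) (k : ℕ) :
    polyChar χ ψ (f ^ k) = polyChar χ ψ f ^ k := by
  induction k with
  | zero => simp [polyChar_one]
  | succ k ih => rw [pow_succ, polyChar_mul χ ψ (hf.pow k) hf, ih, pow_succ]

theorem coeff_X_pow_add_sum (n : ℕ) (c : Fin n → F) (i : Fin n) :
    (X ^ n + ∑ j : Fin n, monomial (j : ℕ) (c j) : F[X]).coeff i = c i := by
  simp [coeff_X_pow, coeff_monomial, i.2.ne, Fin.val_inj]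

variable [Fintype F]

variable (F) in
/-- The finite set of monic polynomials of degree `n` over a finite field. -/
noncomputable def monicPolys (n : ℕ) : Finset F[X] :=
  (Finset.univ : Finset (Fin n → F)).map
    (((monicEquivDegreeLT n).trans (degreeLTEquiv F n).toEquiv).symm.toEmbedding.trans
      (Function.Embedding.subtype _))

theorem mem_monicPolys {n : ℕ} {f : F[X]} :
    f ∈ monicPolys F n ↔ f.Monic ∧ f.natDegree = n := by
  constructor
  · intro h
    obtain ⟨c, -, rfl⟩ := Finset.mem_map.1 h
    exact (((monicEquivDegreeLT n).trans (degreeLTEquiv F n).toEquiv).symm c).2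
  · intro h
    refine Finset.mem_map.2
      ⟨((monicEquivDegreeLT n).trans (degreeLTEquiv F n).toEquiv) ⟨f, h⟩, Finset.mem_univ _, ?_⟩
    simp

theorem sum_monicPolys {M : Type*} [AddCommMonoid M] (n : ℕ) (G : F[X] → M) :
    ∑ f ∈ monicPolys F n, G f = ∑ c : Fin n → F, G (X ^ n + ∑ i : Fin n, monomial (i : ℕ) (c i)) := by
  rw [monicPolys, Finset.sum_map]
  rfl

/-- The coefficient of degree `n` of the L-function attached to `polyChar`. -/
noncomputable def polyCharSum (n : ℕ) : R :=
  ∑ f ∈ monicPolys F n, polyChar χ ψ f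

theorem polyCharSum_zero : polyCharSum χ ψ 0 = 1 := by
  simp [polyCharSum, sum_monicPolys, polyChar_one]

theorem natDegree_X_pow_add_sum (n : ℕ) (c : Fin n → F) :
    (X ^ n + ∑ j : Fin n, monomial (j : ℕ) (c j) : F[X]).natDegree = n :=
  (mem_monicPolys.1 (Finset.mem_map_of_mem _ (Finset.mem_univ c))).2

theorem polyChar_X_pow_add_sum (n : ℕ) (c : Fin (n + 1) → F) :
    polyChar χ ψ (X ^ (n + 1) + ∑ j : Fin (n + 1), monomial (j : ℕ) (c j)) =
      χ ((-1) ^ (n + 1) * c 0) * ψ (-c (Fin.last n)) := by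
  have h0 := coeff_X_pow_add_sum (n + 1) c 0
  have hn := coeff_X_pow_add_sum (n + 1) c (Fin.last n)
  have hd := natDegree_X_pow_add_sum (n + 1) c
  simp only [Fin.val_zero, Fin.val_last] at h0 hn
  rw [polyChar, nextCoeff, hd, h0, if_neg n.succ_ne_zero, Nat.add_sub_cancel, hn]

theorem polyCharSum_one : polyCharSum χ ψ 1 = gaussSum χ ψ := by
  rw [polyCharSum, sum_monicPolys, gaussSum]
  simp only [polyChar_X_pow_add_sum χ ψ 0]
  refine Fintype.sum_equiv ((Equiv.funUnique (Fin 1) F).trans (Equiv.neg F)) _ _ fun c => ?_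
  simp

theorem polyCharSum_eq_zero (hψ : ∑ x, ψ x = 0) (n : ℕ) : polyCharSum χ ψ (n + 2) = 0 := by
  rw [polyCharSum, sum_monicPolys]
  simp only [polyChar_X_pow_add_sum χ ψ (n + 1)]
  rw [← (Fin.snocEquiv fun _ : Fin (n + 2) => F).sum_comp, Fintype.sum_prod_type_right]
  refine Finset.sum_eq_zero fun c _ => ?_
  have h : ∀ x : F, Fin.snocEquiv (fun _ : Fin (n + 2) => F) (x, c) 0 = c 0 := fun x =>
    Fin.snoc_castSucc (α := fun _ => F) x c 0
  have h' : ∀ x : F, Fin.snocEquiv (fun _ : Fin (n + 2) => F) (x, c) (Fin.last (n + 1)) = x :=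
    fun x => Fin.snoc_last (α := fun _ => F) x c
  simp only [h, h']
  rw [← Finset.mul_sum, Fintype.sum_equiv (Equiv.neg F) (fun x => ψ (-x)) ψ fun _ => rfl, hψ,
    mul_zero]

open scoped Classical in
/-- Monic irreducible polynomials of degree `n` over a finite field. -/
noncomputable def irredPolys (F : Type*) [Field F] [Fintype F] (n : ℕ) : Finset F[X] :=
  {f ∈ monicPolys F n | Irreducible f}

theorem mem_irredPolys {n : ℕ} {f : F[X]} :
    f ∈ irredPolys F n ↔ f.Monic ∧ f.natDegree = n ∧ Irreducible f := by
  simp [irredPolys, mem_monicPolys, and_assoc]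

open scoped Classical in
theorem natDegree_eq_sum_irredPolys {f : F[X]} (hf : f.Monic) :
    f.natDegree = ∑ e ∈ Finset.Icc 1 f.natDegree, ∑ P ∈ irredPolys F e,
      ∑ k ∈ Finset.Icc 1 f.natDegree, if P ^ k ∣ f then e else 0 := by
  have hf0 := hf.ne_zero
  have hmon : ∀ P ∈ normalizedFactors f, P.Monic := fun P hP => by
    have := monic_normalize (irreducible_of_normalized_factor P hP).ne_zero
    rwa [normalize_normalized_factor P hP] at this
  have h1 : f.natDegree = ((normalizedFactors f).map natDegree).sum := by
    rw [← natDegree_multiset_prod_of_monic _ hmon]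
    exact natDegree_eq_of_degree_eq (degree_eq_degree_of_associated (prod_normalizedFactors hf0)).symm
  have hmaps : ∀ P ∈ (normalizedFactors f).toFinset, P.natDegree ∈ Finset.Icc 1 f.natDegree := by
    intro P hP
    rw [Multiset.mem_toFinset] at hP
    exact Finset.mem_Icc.2 ⟨(irreducible_of_normalized_factor P hP).natDegree_pos,
      natDegree_le_of_dvd (dvd_of_mem_normalizedFactors hP) hf0⟩
  conv_lhs => rw [h1, Finset.sum_multiset_map_count, ← Finset.sum_fiberwise_of_maps_to hmaps]
  refine Finset.sum_congr rfl fun e he => ?_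
  refine Finset.sum_subset_zero_on_sdiff ?_ ?_ ?_
  · intro P hP
    simp only [Finset.mem_filter, Multiset.mem_toFinset] at hP
    exact mem_irredPolys.2 ⟨hmon P hP.1, hP.2, irreducible_of_normalized_factor P hP.1⟩
  · intro P hP
    simp only [Finset.mem_sdiff, mem_irredPolys, Finset.mem_filter, Multiset.mem_toFinset] at hP
    obtain ⟨⟨hP1, hP2, hP3⟩, hP4⟩ := hP
    refine Finset.sum_eq_zero fun k hk => if_neg fun hdvd => hP4 ⟨?_, hP2⟩
    refine (mem_normalizedFactors_iff' hf0).2 ⟨hP3, hP1.normalize_eq_self, ?_⟩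
    exact (dvd_pow_self P (Nat.one_le_iff_ne_zero.1 (Finset.mem_Icc.1 hk).1)).trans hdvd
  · intro P hP
    simp only [Finset.mem_filter, Multiset.mem_toFinset] at hP
    obtain ⟨hP1, rfl⟩ := hP
    have hirr := irreducible_of_normalized_factor P hP1
    have hcount : ∀ k, P ^ k ∣ f ↔ k ≤ (normalizedFactors f).count P := fun k => by
      rw [pow_dvd_iff_le_emultiplicity, emultiplicity_eq_count_normalizedFactors hirr hf0,
        normalize_normalized_factor P hP1, Nat.cast_le]
    have hle : (normalizedFactors f).count P ≤ f.natDegree := by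
      have := natDegree_le_of_dvd ((hcount _).2 le_rfl) hf0
      rw [natDegree_pow] at this
      exact (Nat.le_mul_of_pos_right _ hirr.natDegree_pos).trans this
    have hfil : {k ∈ Finset.Icc 1 f.natDegree | k ≤ (normalizedFactors f).count P} =
        Finset.Icc 1 ((normalizedFactors f).count P) := by
      ext k
      simp only [Finset.mem_filter, Finset.mem_Icc]
      omega
    simp only [hcount]
    rw [← Finset.sum_filter, hfil]
    simp

open scoped Classical in
theorem sum_polyChar_of_dvd {g : F[X]} (hg : g.Monic) (n : ℕ) :
    ∑ f ∈ monicPolys F n, (if g ∣ f then polyChar χ ψ f else 0) =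
      if g.natDegree ≤ n then polyChar χ ψ g * polyCharSum χ ψ (n - g.natDegree) else 0 := by
  rw [← Finset.sum_filter]
  split_ifs with h
  · rw [polyCharSum, Finset.mul_sum]
    symm
    refine Finset.sum_bij (fun q _ => g * q) ?_ ?_ ?_ ?_
    · intro q hq
      rw [mem_monicPolys] at hq
      rw [Finset.mem_filter, mem_monicPolys]
      exact ⟨⟨hg.mul hq.1, by rw [hg.natDegree_mul hq.1]; omega⟩, dvd_mul_right _ _⟩
    · intro q _ q' _ hqq
      exact mul_left_cancel₀ hg.ne_zero hqq
    · intro f hf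
      rw [Finset.mem_filter, mem_monicPolys] at hf
      obtain ⟨⟨hf1, hf2⟩, q, rfl⟩ := hf
      have hq : q.Monic := hg.of_mul_monic_left hf1
      exact ⟨q, mem_monicPolys.2 ⟨hq, by rw [hg.natDegree_mul hq] at hf2; omega⟩, rfl⟩
    · intro q hq
      exact (polyChar_mul χ ψ hg (mem_monicPolys.1 hq).1).symm
  · refine Finset.sum_eq_zero fun f hf => absurd ?_ h
    rw [Finset.mem_filter, mem_monicPolys] at hf
    exact hf.1.2 ▸ natDegree_le_of_dvd hf.2 hf.1.1.ne_zero

/-- The contribution of the `k`-th powers of irreducible polynomials of degree `e` to the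
logarithmic derivative of the L-function attached to `polyChar`. -/
noncomputable def irredPowSum (e k : ℕ) : R :=
  ∑ P ∈ irredPolys F e, e * polyChar χ ψ P ^ k

theorem natCast_mul_polyCharSum (n : ℕ) :
    n * polyCharSum χ ψ n = ∑ e ∈ Finset.Icc 1 n, ∑ k ∈ Finset.Icc 1 n,
      if e * k ≤ n then irredPowSum χ ψ e k * polyCharSum χ ψ (n - e * k) else 0 := by
  classical
  calc (n : R) * polyCharSum χ ψ n
      = ∑ f ∈ monicPolys F n, ∑ e ∈ Finset.Icc 1 n, ∑ P ∈ irredPolys F e,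
          ∑ k ∈ Finset.Icc 1 n, e * if P ^ k ∣ f then polyChar χ ψ f else 0 := by
        rw [polyCharSum, Finset.mul_sum]
        refine Finset.sum_congr rfl fun f hf => ?_
        obtain ⟨hmon, rfl⟩ := mem_monicPolys.1 hf
        conv_lhs => rw [natDegree_eq_sum_irredPolys hmon]
        simp [Finset.sum_mul]
    _ = ∑ e ∈ Finset.Icc 1 n, ∑ P ∈ irredPolys F e, ∑ k ∈ Finset.Icc 1 n,
          e * if e * k ≤ n then polyChar χ ψ P ^ k * polyCharSum χ ψ (n - e * k) else 0 := by
        rw [Finset.sum_comm]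
        refine Finset.sum_congr rfl fun e _ => ?_
        rw [Finset.sum_comm]
        refine Finset.sum_congr rfl fun P hP => ?_
        rw [Finset.sum_comm]
        refine Finset.sum_congr rfl fun k _ => ?_
        obtain ⟨hmon, rfl, -⟩ := mem_irredPolys.1 hP
        rw [← Finset.mul_sum, sum_polyChar_of_dvd χ ψ (hmon.pow k), polyChar_pow χ ψ hmon,
          natDegree_pow, mul_comm k]
    _ = _ := by
        refine Finset.sum_congr rfl fun e _ => ?_
        rw [Finset.sum_comm]
        refine Finset.sum_congr rfl fun k _ => ?_
        split_ifs
        · rw [irredPowSum, Finset.sum_mul]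
          exact Finset.sum_congr rfl fun P _ => (mul_assoc _ _ _).symm
        · simp

/-- The coefficient of degree `n` of the logarithmic derivative of the L-function attached to
`polyChar`. -/
noncomputable def logDerivCoeff (n : ℕ) : R :=
  ∑ p ∈ n.divisorsAntidiagonal, irredPowSum χ ψ p.1 p.2

theorem sum_mul_eq_logDerivCoeff {m n : ℕ} (hm : m ≠ 0) (hmn : m ≤ n) :
    ∑ e ∈ Finset.Icc 1 n, ∑ k ∈ Finset.Icc 1 n,
      (if e * k = m then irredPowSum χ ψ e k else 0) = logDerivCoeff χ ψ m := by
  rw [← Finset.sum_product', ← Finset.sum_filter, logDerivCoeff]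
  refine Finset.sum_congr ?_ fun _ _ => rfl
  ext ⟨e, k⟩
  simp only [Finset.mem_filter, Finset.mem_product, Finset.mem_Icc, Nat.mem_divisorsAntidiagonal]
  constructor
  · exact fun h => ⟨h.2, hm⟩
  · rintro ⟨rfl, h⟩
    have he := Nat.pos_of_ne_zero (left_ne_zero_of_mul h)
    have hk := Nat.pos_of_ne_zero (right_ne_zero_of_mul h)
    exact ⟨⟨⟨he, (Nat.le_mul_of_pos_right _ hk).trans hmn⟩, hk,
      (Nat.le_mul_of_pos_left _ he).trans hmn⟩, rfl⟩

theorem logDerivCoeff_one : logDerivCoeff χ ψ 1 = gaussSum χ ψ := by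
  have := natCast_mul_polyCharSum χ ψ 1
  simp only [polyCharSum_one, Nat.cast_one, one_mul, Finset.Icc_self, Finset.sum_singleton,
    mul_one, le_refl, if_true, Nat.sub_self, polyCharSum_zero] at this
  simp [logDerivCoeff, this]

theorem logDerivCoeff_add_two (hψ : ∑ x, ψ x = 0) (n : ℕ) :
    logDerivCoeff χ ψ (n + 2) = -(logDerivCoeff χ ψ (n + 1) * gaussSum χ ψ) := by
  rw [eq_neg_iff_add_eq_zero, ← sum_mul_eq_logDerivCoeff χ ψ (n + 1).succ_ne_zero le_rfl,
    ← sum_mul_eq_logDerivCoeff χ ψ n.succ_ne_zero (n + 1).le_succ]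
  have h := natCast_mul_polyCharSum χ ψ (n + 2)
  rw [polyCharSum_eq_zero χ ψ hψ, mul_zero] at h
  refine Eq.trans ?_ h.symm
  rw [Finset.sum_mul, ← Finset.sum_add_distrib]
  refine Finset.sum_congr rfl fun e _ => ?_
  rw [Finset.sum_mul, ← Finset.sum_add_distrib]
  refine Finset.sum_congr rfl fun k _ => ?_
  generalize e * k = m
  rcases lt_or_ge (n + 2) m with hm | hm
  · rw [if_neg (by omega), if_neg (by omega), if_neg (by omega), zero_mul, add_zero]
  obtain ⟨j, hj⟩ := Nat.exists_eq_add_of_le hm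
  rw [if_pos hm, hj, Nat.add_sub_cancel_left]
  match j with
  | 0 => rw [if_pos (by omega), if_neg (by omega), polyCharSum_zero]; ring
  | 1 => rw [if_neg (by omega), if_pos (by omega), polyCharSum_one]; ring
  | j + 2 =>
    rw [if_neg (by omega), if_neg (by omega), polyCharSum_eq_zero χ ψ hψ]
    ring

theorem logDerivCoeff_succ (hψ : ∑ x, ψ x = 0) (n : ℕ) :
    logDerivCoeff χ ψ (n + 1) = (-1) ^ n * gaussSum χ ψ ^ (n + 1) := by
  induction n with
  | zero => simp [logDerivCoeff_one]
  | succ n ih => rw [logDerivCoeff_add_two χ ψ hψ, ih]; ring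

variable {E : Type*} [Field E] [Fintype E] [Algebra F E]

open IntermediateField in
omit [Fintype F] in
theorem char_norm_mul_char_trace (t : E) {e k : ℕ} (he : (minpoly F t).natDegree = e)
    (hek : e * k = Module.finrank F E) :
    χ (Algebra.norm F t) * ψ (Algebra.trace F E t) = polyChar χ ψ (minpoly F t) ^ k := by
  have hint : IsIntegral F t := .of_finite F t
  have hk : Module.finrank F⟮t⟯ E = k := by
    have h := Module.finrank_mul_finrank F F⟮t⟯ E
    rw [adjoin.finrank hint, he, ← hek] at h
    exact Nat.eq_of_mul_eq_mul_left (he ▸ minpoly.natDegree_pos hint) h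
  have hN : Algebra.norm F (AdjoinSimple.gen F t) =
      (-1) ^ (minpoly F t).natDegree * (minpoly F t).coeff 0 := by
    have h := Algebra.PowerBasis.norm_gen_eq_coeff_zero_minpoly (adjoin.powerBasis hint)
    rwa [adjoin.powerBasis_gen, minpoly_gen, adjoin.powerBasis_dim] at h
  rw [Algebra.norm_eq_norm_adjoin, trace_eq_trace_adjoin, trace_adjoinSimpleGen hint, hk, hN,
    AddChar.map_nsmul_eq_pow, map_pow, ← mul_pow, polyChar]

theorem card_filter_minpoly_eq [DecidableEq F[X]] {P : F[X]} (hP : P.Monic) (hirr : Irreducible P)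
    (hdvd : P.natDegree ∣ Module.finrank F E) :
    (Finset.univ.filter fun t : E => minpoly F t = P).card = P.natDegree := by
  classical
  have hsplit : (P.map (algebraMap F E)).Splits := by
    have h := hirr.natDegree_dvd_iff_dvd_X_pow_card_pow_sub_X.1 hdvd
    rw [← Module.natCard_eq_pow_finrank, Nat.card_eq_fintype_card] at h
    refine (FiniteField.isSplittingField_sub E F).splits.of_dvd ?_ (map_dvd (algebraMap F E) h)
    exact map_ne_zero (FiniteField.X_pow_card_sub_X_ne_zero F Fintype.one_lt_card)
  rw [← card_rootSet_eq_natDegree (PerfectField.separable_of_irreducible hirr) hsplit,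
    Fintype.card_subtype]
  congr 1
  ext t
  simp only [Finset.mem_filter, Finset.mem_univ, true_and, mem_rootSet_of_ne hP.ne_zero]
  exact ⟨fun h => h ▸ minpoly.aeval F t,
    fun h => (minpoly.eq_of_irreducible_of_monic hirr h hP).symm⟩

theorem sum_char_norm_mul_char_trace :
    ∑ t : E, χ (Algebra.norm F t) * ψ (Algebra.trace F E t) =
      logDerivCoeff χ ψ (Module.finrank F E) := by
  classical
  have hpos : Module.finrank F E ≠ 0 := Module.finrank_pos.ne'
  have hmaps : ∀ t ∈ (Finset.univ : Finset E), (⟨(minpoly F t).natDegree,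
      Module.finrank F E / (minpoly F t).natDegree⟩ : ℕ × ℕ) ∈
        (Module.finrank F E).divisorsAntidiagonal := fun t _ =>
    Nat.mem_divisorsAntidiagonal.2 ⟨Nat.mul_div_cancel' (minpoly.degree_dvd (.of_finite F t)), hpos⟩
  rw [logDerivCoeff, ← Finset.sum_fiberwise_of_maps_to hmaps]
  refine Finset.sum_congr rfl fun ⟨e, k⟩ hp => ?_
  obtain ⟨hek, -⟩ := Nat.mem_divisorsAntidiagonal.1 hp
  dsimp only at hek ⊢
  have hmaps' : ∀ t ∈ (Finset.univ.filter fun t : E => ((minpoly F t).natDegree,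
      Module.finrank F E / (minpoly F t).natDegree) = (e, k)), minpoly F t ∈ irredPolys F e := by
    intro t ht
    have hint : IsIntegral F t := .of_finite F t
    exact mem_irredPolys.2 ⟨minpoly.monic hint, congrArg Prod.fst (Finset.mem_filter.1 ht).2,
      minpoly.irreducible hint⟩
  rw [irredPowSum, ← Finset.sum_fiberwise_of_maps_to hmaps']
  refine Finset.sum_congr rfl fun P hP => ?_
  obtain ⟨hmon, rfl, hirr⟩ := mem_irredPolys.1 hP
  rw [Finset.filter_filter]
  have hfil : (Finset.univ.filter fun t : E => ((minpoly F t).natDegree,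
      Module.finrank F E / (minpoly F t).natDegree) = (P.natDegree, k) ∧ minpoly F t = P) =
      Finset.univ.filter fun t : E => minpoly F t = P := by
    refine Finset.filter_congr fun t _ => and_iff_right_of_imp ?_
    rintro h
    rw [h, ← hek, Nat.mul_div_cancel_left _ hirr.natDegree_pos]
  rw [hfil, Finset.sum_congr rfl (g := fun _ => polyChar χ ψ P ^ k), Finset.sum_const,
    card_filter_minpoly_eq hmon hirr (hek ▸ dvd_mul_right _ _), nsmul_eq_mul]
  intro t ht
  obtain rfl := (Finset.mem_filter.1 ht).2
  exact char_norm_mul_char_trace χ ψ t rfl hek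

/-- The **Hasse–Davenport relation**, with values in an arbitrary commutative ring. -/
theorem gaussSum_pow_finrank (hψ : ∑ x, ψ x = 0) :
    gaussSum χ ψ ^ Module.finrank F E = (-1) ^ (Module.finrank F E - 1) *
      ∑ t : E, χ (Algebra.norm F t) * ψ (Algebra.trace F E t) := by
  obtain ⟨n, hn⟩ := Nat.exists_eq_succ_of_ne_zero (Module.finrank_pos (R := F) (M := E)).ne'
  rw [sum_char_norm_mul_char_trace, hn, Nat.succ_eq_add_one, logDerivCoeff_succ χ ψ hψ,
    Nat.add_sub_cancel, ← mul_assoc, ← mul_pow]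
  simp

end HasseDavenport

section Kloosterman

theorem sum_units_eq_sum {K M : Type*} [Field K] [Fintype K] [DecidableEq K] [AddCommMonoid M]
    (f : K → M) (hf : f 0 = 0) : ∑ u : Kˣ, f u = ∑ x, f x := by
  refine Finset.sum_of_injOn Units.val Units.val_injective.injOn (fun _ _ => Finset.mem_univ _)
    (fun x _ hx => ?_) fun _ _ => rfl
  by_cases h : x = 0
  · rw [h, hf]
  · exact absurd ⟨Units.mk0 x h, by simp⟩ hx

theorem AddChar.map_finset_sum {A M ι : Type*} [AddCommMonoid A] [CommMonoid M] (ψ : AddChar A M)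
    (s : Finset ι) (f : ι → A) : ψ (∑ i ∈ s, f i) = ∏ i ∈ s, ψ (f i) :=
  map_prod ψ.toMonoidHom (fun i => Multiplicative.ofAdd (f i)) s

variable {kF kE : Type*} [Field kF] [Fintype kF] [DecidableEq kF]
  [Field kE] [Fintype kE] [DecidableEq kE] [Algebra kF kE] (ψ : AddChar kF ℂ)

variable (kF) in
/-- The tautological multiplicative character with values in the group algebra of `kFˣ`. -/
noncomputable def tautologicalMulChar : MulChar kF (MonoidAlgebra ℂ kFˣ) :=
  MulChar.ofUnitHom ((Units.map (MonoidAlgebra.of ℂ kFˣ)).comp toUnits.toMonoidHom)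

omit [Fintype kF] [DecidableEq kF] in
theorem tautologicalMulChar_coe (u : kFˣ) :
    tautologicalMulChar kF (u : kF) = MonoidAlgebra.single u 1 := by
  simp [tautologicalMulChar]

/-- An additive character viewed with values in the group algebra of `kFˣ`. -/
noncomputable def scalarAddChar : AddChar kF (MonoidAlgebra ℂ kFˣ) :=
  ((algebraMap ℂ (MonoidAlgebra ℂ kFˣ) : ℂ →+* _) : ℂ →* _).compAddChar ψ

omit [Fintype kF] [DecidableEq kF] in
theorem tautologicalMulChar_mul_scalarAddChar (u : kFˣ) (x : kF) :
    tautologicalMulChar kF (u : kF) * scalarAddChar ψ x = MonoidAlgebra.single u (ψ x) := by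
  simp [tautologicalMulChar_coe, scalarAddChar, MonoidAlgebra.single_mul_single]

theorem sum_prod_eq_sum_norm_eq (hψ : ψ ≠ 1) (b : kFˣ) :
    ∑ s : Fin (Module.finrank kF kE) → kFˣ,
        (if ∏ j, s j = b then ψ (∑ j, ((s j : kF))) else 0) =
      (-1) ^ (Module.finrank kF kE - 1) * ∑ t : kEˣ,
        if Units.map (Algebra.norm kF) t = b then ψ (Algebra.trace kF kE t) else 0 := by
  have hsum : ∑ x, scalarAddChar ψ x = 0 := by
    have h := congrArg (algebraMap ℂ (MonoidAlgebra ℂ kFˣ)) (AddChar.sum_eq_zero_of_ne_one hψ)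
    rwa [map_sum, map_zero] at h
  have h := gaussSum_pow_finrank (E := kE) (tautologicalMulChar kF) (scalarAddChar ψ) hsum
  have h0 : tautologicalMulChar kF 0 = 0 := MulChar.map_nonunit _ not_isUnit_zero
  rw [gaussSum, ← sum_units_eq_sum (K := kF) _ (by simp [h0]),
    ← sum_units_eq_sum (K := kE) _ (by simp [h0]), Fintype.sum_pow] at h
  have hN : ∀ t : kEˣ, tautologicalMulChar kF (Algebra.norm kF (t : kE)) *
      scalarAddChar ψ (Algebra.trace kF kE t) =
        MonoidAlgebra.single (Units.map (Algebra.norm kF) t) (ψ (Algebra.trace kF kE t)) :=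
    fun t => tautologicalMulChar_mul_scalarAddChar ψ (Units.map (Algebra.norm kF) t) _
  have hc : ((-1) ^ (Module.finrank kF kE - 1) : MonoidAlgebra ℂ kFˣ) =
      algebraMap ℂ _ ((-1) ^ (Module.finrank kF kE - 1)) := by
    rw [map_pow, map_neg, map_one]
  simp only [tautologicalMulChar_mul_scalarAddChar, hN, MonoidAlgebra.prod_single, hc,
    ← Algebra.smul_def] at h
  have hb := congrArg (fun x => x.coeff b) h
  simpa only [MonoidAlgebra.coeff_sum, MonoidAlgebra.coeff_smul_apply, Finsupp.finsetSum_apply,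
    MonoidAlgebra.coeff_single, Finsupp.single_apply, smul_eq_mul, AddChar.map_finset_sum] using hb

end Kloosterman

/-- Hasse–Davenport type relation for Kloosterman sums: if `r = [k_E : k_F]`, then
`Kl_a^{n,r} = (−1)^{r−1} · Kl_a^{n+1,0}`. -/
theorem stmt3 (kF kE : Type) [Field kF] [Fintype kF] [DecidableEq kF]
    [Field kE] [Fintype kE] [DecidableEq kE] [Algebra kF kE]
    (ψ : AddChar kF ℂ) (hψ : ψ ≠ 1) (n : ℕ) (a : kFˣ)
    (r : ℕ) (hr : r = Module.finrank kF kE) :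
    Kl kF kE ψ n r (a : kF) = (-1 : ℂ) ^ (r - 1) * Kl kF kE ψ (n + 1) 0 (a : kF) := by
  subst hr
  have hL : Kl kF kE ψ n (Module.finrank kF kE) (a : kF) = ∑ t : Fin n → kEˣ,
      ψ (Algebra.trace kF kE (∑ i, (t i : kE))) *
        ∑ s : Fin (Module.finrank kF kE) → kFˣ,
          if ∏ j, s j = (∏ i, Units.map (Algebra.norm kF) (t i))⁻¹ * a then
            ψ (∑ j, (s j : kF)) else 0 := by
    rw [Kl]
    refine Finset.sum_congr rfl fun t _ => ?_
    rw [Finset.mul_sum]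
    refine Finset.sum_congr rfl fun s _ => ?_
    rw [mul_ite, mul_zero]
    refine if_congr ?_ rfl rfl
    rw [eq_inv_mul_iff_mul_eq, ← Units.val_inj]
    simp
  have hR : Kl kF kE ψ (n + 1) 0 (a : kF) = ∑ t : Fin n → kEˣ,
      ψ (Algebra.trace kF kE (∑ i, (t i : kE))) *
        ∑ u : kEˣ, if Units.map (Algebra.norm kF) u =
            (∏ i, Units.map (Algebra.norm kF) (t i))⁻¹ * a then
          ψ (Algebra.trace kF kE u) else 0 := by
    rw [Kl, ← (Fin.snocEquiv fun _ : Fin (n + 1) => kEˣ).sum_comp, Fintype.sum_prod_type_right]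
    refine Finset.sum_congr rfl fun t _ => ?_
    rw [Finset.mul_sum]
    refine Finset.sum_congr rfl fun u _ => ?_
    rw [mul_ite, mul_zero, Fintype.sum_unique]
    refine if_congr ?_ ?_ rfl
    · rw [eq_inv_mul_iff_mul_eq, ← Units.val_inj]
      simp [Fin.prod_univ_castSucc]
    · simp [Fin.sum_univ_castSucc, AddChar.map_add_eq_mul]
  rw [hL, hR, Finset.mul_sum]
  refine Finset.sum_congr rfl fun t _ => ?_
  rw [sum_prod_eq_sum_norm_eq ψ hψ]
  ring
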